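/- arXiv:1901.07735 — 3 statements merged into one kernel-verified Lean document; each statement's English description precedes it below -/
import Mathlib

section
/- Let G be the hypertree HT(n) with n ≥ 1. Then the total domination number of G is γ_t(G) = (2^{n+2}+3)/7 if n ≡ 0 (mod 3), γ_t(G) = (2^{n+2}-1)/7 + 1 if n ≡ 1 (mod 3), and γ_t(G) = 2(2^{n+1}-1)/7 if n ≡ 2 (mod 3). -/
/-- Vertex labels of a level-`n` complete binary tree: `1, …, 2^(n+1) - 1`. -/
def treeVerts (n : ℕ) : Finset ℕ := Finset.Icc 1 (2 ^ (n + 1) - 1)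

/-- The hypertree `HT(n)`: each vertex `x` is adjacent to its children `2x` and `2x+1`
(when the labels lie in the vertex set), and two vertices at the same level `i`
(`1 ≤ i ≤ n`, i.e. `2^i ≤ x < 2^(i+1)`) are adjacent iff their labels differ by `2^(i-1)`. -/
def hyperTree (n : ℕ) : SimpleGraph ℕ :=
  SimpleGraph.fromRel (fun x y =>
    x ∈ treeVerts n ∧ y ∈ treeVerts n ∧
      (y = 2 * x ∨ y = 2 * x + 1 ∨
        ∃ i, 1 ≤ i ∧ i ≤ n ∧ 2 ^ i ≤ x ∧ x < 2 ^ (i + 1) ∧ 2 ^ i ≤ y ∧ y < 2 ^ (i + 1) ∧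
          y = x + 2 ^ (i - 1)))

/-- The root-fault hypertree `HT*(n)`: the induced subgraph of `HT(n)` obtained by
deleting the root vertex `1`. -/
def rootFaultHyperTree (n : ℕ) : SimpleGraph ℕ :=
  SimpleGraph.fromRel (fun x y => x ≠ 1 ∧ y ≠ 1 ∧ (hyperTree n).Adj x y)

/-- Vertex labels of the root-fault hypertree `HT*(n)`: `2, …, 2^(n+1) - 1`. -/
def rootFaultVerts (n : ℕ) : Finset ℕ := Finset.Icc 2 (2 ^ (n + 1) - 1)

/-- The sibling tree `ST_n`: each vertex `x` is adjacent to its children `2x` and `2x+1`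
(when the labels lie in the vertex set), and the two children `2p`, `2p+1` of a common
parent are adjacent. -/
def siblingTree (n : ℕ) : SimpleGraph ℕ :=
  SimpleGraph.fromRel (fun x y =>
    x ∈ treeVerts n ∧ y ∈ treeVerts n ∧
      (y = 2 * x ∨ y = 2 * x + 1 ∨ ∃ p, x = 2 * p ∧ y = 2 * p + 1))

/-- `S` is a dominating set of the graph `G` with (finite) vertex set `V`:
every vertex of `V` not in `S` is adjacent to some vertex of `S`. -/
def IsDomSetOn (G : SimpleGraph ℕ) (V S : Finset ℕ) : Prop :=
  S ⊆ V ∧ ∀ v ∈ V, v ∉ S → ∃ u ∈ S, G.Adj u v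

/-- `S` is a total dominating set of the graph `G` with (finite) vertex set `V`:
every vertex of `V` is adjacent to some vertex of `S`. -/
def IsTotalDomSetOn (G : SimpleGraph ℕ) (V S : Finset ℕ) : Prop :=
  S ⊆ V ∧ ∀ v ∈ V, ∃ u ∈ S, G.Adj u v

/-- `S` locates the vertices of `V` outside `S`: any two distinct vertices `u, v` of `V`
outside `S` satisfy `N(u) ∩ S ≠ N(v) ∩ S`. -/
def LocatesOn (G : SimpleGraph ℕ) (V S : Finset ℕ) : Prop :=
  ∀ u ∈ V, ∀ v ∈ V, u ∉ S → v ∉ S → u ≠ v →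
    ({w : ℕ | w ∈ S ∧ G.Adj w u} ≠ {w : ℕ | w ∈ S ∧ G.Adj w v})

/-- `S` is a locating-dominating set of `G` with vertex set `V`. -/
def IsLocDomSetOn (G : SimpleGraph ℕ) (V S : Finset ℕ) : Prop :=
  IsDomSetOn G V S ∧ LocatesOn G V S

/-- `S` is a locating-total dominating set of `G` with vertex set `V`. -/
def IsLocTotalDomSetOn (G : SimpleGraph ℕ) (V S : Finset ℕ) : Prop :=
  IsTotalDomSetOn G V S ∧ LocatesOn G V S

/-- The domination number `γ` of the graph `G` with vertex set `V`. -/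
noncomputable def domNum (G : SimpleGraph ℕ) (V : Finset ℕ) : ℕ :=
  sInf {k | ∃ S : Finset ℕ, IsDomSetOn G V S ∧ S.card = k}

/-- The total domination number `γ_t` of the graph `G` with vertex set `V`. -/
noncomputable def totalDomNum (G : SimpleGraph ℕ) (V : Finset ℕ) : ℕ :=
  sInf {k | ∃ S : Finset ℕ, IsTotalDomSetOn G V S ∧ S.card = k}

/-- The locating-domination number `γ^L` of the graph `G` with vertex set `V`. -/
noncomputable def locDomNum (G : SimpleGraph ℕ) (V : Finset ℕ) : ℕ :=
  sInf {k | ∃ S : Finset ℕ, IsLocDomSetOn G V S ∧ S.card = k}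

/-- The locating-total domination number `γ^L_t` of the graph `G` with vertex set `V`. -/
noncomputable def locTotalDomNum (G : SimpleGraph ℕ) (V : Finset ℕ) : ℕ :=
  sInf {k | ∃ S : Finset ℕ, IsLocTotalDomSetOn G V S ∧ S.card = k}

theorem hyperTree_mono {m n : ℕ} (h : m ≤ n) {u v : ℕ} (huv : (hyperTree m).Adj u v) :
    (hyperTree n).Adj u v := by
  have hp : 2 ^ (m + 1) ≤ 2 ^ (n + 1) := Nat.pow_le_pow_right (by norm_num) (by omega)
  have key : ∀ {x}, x ∈ treeVerts m → x ∈ treeVerts n := by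
    intro x hx
    simp only [treeVerts, Finset.mem_Icc] at hx ⊢
    omega
  simp only [hyperTree, SimpleGraph.fromRel_adj] at huv ⊢
  obtain ⟨hne, h1⟩ := huv
  refine ⟨hne, h1.imp ?_ ?_⟩ <;>
  · rintro ⟨hx, hy, h2⟩
    refine ⟨key hx, key hy, h2.imp_right (Or.imp_right ?_)⟩
    rintro ⟨i, hi, him, h3⟩
    exact ⟨i, hi, him.trans h, h3⟩

/-- In `HT(n)`, a parent is adjacent to its children. -/
theorem hyperTree_adj_child {n x y : ℕ} (hx : 1 ≤ x) (hxy : y = 2 * x ∨ y = 2 * x + 1)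
    (hy : y < 2 ^ (n + 1)) : (hyperTree n).Adj x y := by
  simp only [hyperTree, SimpleGraph.fromRel_adj, treeVerts, Finset.mem_Icc]
  exact ⟨by omega, Or.inl ⟨by omega, by omega, hxy.imp_right Or.inl⟩⟩

/-- In `HT(n)`, two vertices of level `i + 1` whose labels differ by `2 ^ i` are adjacent. -/
theorem hyperTree_adj_level {n i x : ℕ} (hi : i + 1 ≤ n) (hx : 2 ^ (i + 1) ≤ x)
    (hx' : x < 2 ^ (i + 1) + 2 ^ i) : (hyperTree n).Adj x (x + 2 ^ i) := by
  have hp : 2 ^ (i + 2) ≤ 2 ^ (n + 1) := Nat.pow_le_pow_right (by norm_num) (by omega)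
  have h0 : 0 < 2 ^ i := by positivity
  have h1 : 2 ^ (i + 1) = 2 * 2 ^ i := pow_succ' 2 i
  have h2 : 2 ^ (i + 2) = 4 * 2 ^ i := by ring
  simp only [hyperTree, SimpleGraph.fromRel_adj, treeVerts, Finset.mem_Icc]
  refine ⟨by omega, Or.inl ⟨by omega, by omega, Or.inr (Or.inr ?_)⟩⟩
  exact ⟨i + 1, by omega, hi, by omega, by rw [show i + 1 + 1 = i + 2 from rfl]; omega,
    by omega, by rw [show i + 1 + 1 = i + 2 from rfl]; omega, rfl⟩

/-- Every vertex of a level `i + 1` of `HT(n)` is adjacent to a vertex of the same level. -/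
theorem exists_hyperTree_adj_level {n i x : ℕ} (hi : i + 1 ≤ n) (hx : 2 ^ (i + 1) ≤ x)
    (hx' : x < 2 ^ (i + 2)) :
    ∃ u, 2 ^ (i + 1) ≤ u ∧ u < 2 ^ (i + 2) ∧ (hyperTree n).Adj u x := by
  have h0 : 0 < 2 ^ i := by positivity
  have h1 : 2 ^ (i + 1) = 2 * 2 ^ i := pow_succ' 2 i
  have h2 : 2 ^ (i + 2) = 4 * 2 ^ i := by ring
  by_cases h : x < 2 ^ (i + 1) + 2 ^ i
  · exact ⟨x + 2 ^ i, by omega, by omega, (hyperTree_adj_level hi hx h).symm⟩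
  · refine ⟨x - 2 ^ i, by omega, by omega, ?_⟩
    have := hyperTree_adj_level (n := n) (x := x - 2 ^ i) hi (by omega) (by omega)
    rwa [Nat.sub_add_cancel (by omega)] at this

/-- The possible neighbours in `HT(n)` of a vertex `x` of level `j + 1`. -/
theorem hyperTree_adj_cases {n j u x : ℕ} (hx : 2 ^ (j + 1) ≤ x) (hx' : x < 2 ^ (j + 2))
    (h : (hyperTree n).Adj u x) :
    u = x / 2 ∨ u = 2 * x ∨ u = 2 * x + 1 ∨
      2 ^ (j + 1) ≤ u ∧ u < 2 ^ (j + 2) ∧ (u = x + 2 ^ j ∨ x = u + 2 ^ j) := by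
  have level : ∀ i, 2 ^ i ≤ x → x < 2 ^ (i + 1) → i = j + 1 := by
    intro i h1 h2
    have h3 := (Nat.pow_lt_pow_iff_right (a := 2) (by norm_num)).1 (h1.trans_lt hx')
    have h4 := (Nat.pow_lt_pow_iff_right (a := 2) (by norm_num)).1 (hx.trans_lt h2)
    omega
  simp only [hyperTree, SimpleGraph.fromRel_adj] at h
  obtain ⟨-, ⟨-, -, h | h | ⟨i, -, -, h1, h2, h3, h4, h5⟩⟩ |
    ⟨-, -, h | h | ⟨i, -, -, h1, h2, h3, h4, h5⟩⟩⟩ := h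
  · omega
  · omega
  · obtain rfl := level i h3 h4
    exact Or.inr (Or.inr (Or.inr ⟨h1, h2, Or.inr h5⟩))
  · omega
  · omega
  · obtain rfl := level i h1 h2
    exact Or.inr (Or.inr (Or.inr ⟨h3, h4, Or.inl h5⟩))

/-- A total dominating set of `HT(n)` has at least `2 ^ (j + 1)` vertices in levels
`j + 1`, `j + 2`, `j + 3`: the even vertices of level `j + 2` have pairwise disjoint open
neighbourhoods lying in these levels. -/
theorem IsTotalDomSetOn.card_filter_add_le {n j : ℕ} {S : Finset ℕ}
    (hS : IsTotalDomSetOn (hyperTree n) (treeVerts n) S) (hj : j + 2 ≤ n) :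
    (S.filter (· < 2 ^ (j + 1))).card + 2 ^ (j + 1) ≤ (S.filter (· < 2 ^ (j + 4))).card := by
  have hp : 2 ^ (j + 3) ≤ 2 ^ (n + 1) := Nat.pow_le_pow_right (by norm_num) (by omega)
  have h0 : 0 < 2 ^ j := by positivity
  have e1 : 2 ^ (j + 1) = 2 * 2 ^ j := by ring
  have e2 : 2 ^ (j + 2) = 4 * 2 ^ j := by ring
  have e3 : 2 ^ (j + 3) = 8 * 2 ^ j := by ring
  have e4 : 2 ^ (j + 4) = 16 * 2 ^ j := by ring
  have ex : ∀ q ∈ Finset.Ico (2 ^ (j + 1)) (2 ^ (j + 2)), ∃ u ∈ S, (hyperTree n).Adj u (2 * q) := by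
    intro q hq
    apply hS.2
    simp only [treeVerts, Finset.mem_Icc, Finset.mem_Ico] at hq ⊢
    omega
  choose! f hfS hf using ex
  have nbr : ∀ q ∈ Finset.Ico (2 ^ (j + 1)) (2 ^ (j + 2)),
      f q = q ∨ f q = 4 * q ∨ f q = 4 * q + 1 ∨ 4 * 2 ^ j ≤ f q ∧ f q < 8 * 2 ^ j ∧
        (f q = 2 * q + 2 * 2 ^ j ∨ 2 * q = f q + 2 * 2 ^ j) := by
    intro q hq
    have h := hf q hq
    simp only [Finset.mem_Ico] at hq
    have := hyperTree_adj_cases (j := j + 1) (by rw [show j + 1 + 1 = j + 2 from rfl]; omega)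
      (by rw [show j + 1 + 2 = j + 3 from rfl]; omega) h
    rw [show j + 1 + 1 = j + 2 from rfl, show j + 1 + 2 = j + 3 from rfl, e1, e2, e3] at this
    omega
  have hcard : ((Finset.Ico (2 ^ (j + 1)) (2 ^ (j + 2))).image f).card = 2 ^ (j + 1) := by
    rw [Finset.card_image_of_injOn, Nat.card_Ico]
    · omega
    · intro a ha b hb hab
      have h1 := nbr a ha
      have h2 := nbr b hb
      simp only [Finset.coe_Ico, Set.mem_Ico] at ha hb
      rw [e1, e2] at ha hb
      omega
  rw [← hcard, ← Finset.card_union_of_disjoint]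
  · apply Finset.card_le_card
    intro u hu
    simp only [Finset.mem_union, Finset.mem_filter, Finset.mem_image] at hu ⊢
    obtain ⟨h1, h2⟩ | ⟨q, hq, rfl⟩ := hu
    · exact ⟨h1, by omega⟩
    · have := nbr q hq
      refine ⟨hfS q hq, ?_⟩
      simp only [Finset.mem_Ico] at hq
      omega
  · rw [Finset.disjoint_left]
    intro u hu hu'
    simp only [Finset.mem_filter, Finset.mem_image] at hu hu'
    obtain ⟨q, hq, rfl⟩ := hu'
    have := nbr q hq
    simp only [Finset.mem_Ico] at hq
    omega

/-- The lower bound for total domination in `HT(n)`, propagated from level `r` in steps of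
three levels. -/
theorem IsTotalDomSetOn.pow_add_le_card {n r C D : ℕ} {S : Finset ℕ}
    (hS : IsTotalDomSetOn (hyperTree n) (treeVerts n) S)
    (hr : 2 ^ (r + 1) + C ≤ 7 * (S.filter (· < 2 ^ (r + 1))).card + D) (k : ℕ)
    (hk : n + 1 = r + 3 * k) : 2 ^ (n + 2) + C ≤ 7 * S.card + D := by
  have main : ∀ i ≤ k,
      2 ^ (r + 3 * i + 1) + C ≤ 7 * (S.filter (· < 2 ^ (r + 3 * i + 1))).card + D := by
    intro i
    induction i with
    | zero => intro _; exact hr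
    | succ i ih =>
      intro hi
      have h1 := ih (by omega)
      have h2 := hS.card_filter_add_le (j := r + 3 * i) (by omega)
      rw [show r + 3 * (i + 1) + 1 = r + 3 * i + 4 by ring]
      have e1 : 2 ^ (r + 3 * i + 1) = 2 * 2 ^ (r + 3 * i) := by ring
      have e2 : 2 ^ (r + 3 * i + 4) = 16 * 2 ^ (r + 3 * i) := by ring
      omega
  have h := main k le_rfl
  rw [← hk] at h
  have := Finset.card_filter_le S (· < 2 ^ (n + 1 + 1))
  rw [show n + 2 = n + 1 + 1 from rfl]
  omega

theorem IsTotalDomSetOn.exists_mem_level_one {n : ℕ} (hn : 1 ≤ n) {S : Finset ℕ}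
    (hS : IsTotalDomSetOn (hyperTree n) (treeVerts n) S) : ∃ u ∈ S, u = 2 ∨ u = 3 := by
  have hp : 2 ^ (1 + 1) ≤ 2 ^ (n + 1) := Nat.pow_le_pow_right (by norm_num) (by omega)
  obtain ⟨u, hu, h⟩ := hS.2 1 (by simp only [treeVerts, Finset.mem_Icc]; omega)
  refine ⟨u, hu, ?_⟩
  simp only [hyperTree, SimpleGraph.fromRel_adj, treeVerts, Finset.mem_Icc] at h
  obtain ⟨-, ⟨h0, -, h | h | ⟨i, hi, -, h1, h2, h3, h4, h5⟩⟩ |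
    ⟨-, -, h | h | ⟨i, hi, -, h1, h2, h3, h4, h5⟩⟩⟩ := h
  · omega
  · omega
  · have := Nat.pow_le_pow_right (n := 2) (by norm_num) hi
    omega
  · omega
  · omega
  · have := Nat.pow_le_pow_right (n := 2) (by norm_num) hi
    omega

theorem IsTotalDomSetOn.one_le_card_filter {n : ℕ} (hn : 1 ≤ n) {S : Finset ℕ}
    (hS : IsTotalDomSetOn (hyperTree n) (treeVerts n) S) :
    1 ≤ (S.filter (· < 2 ^ 2)).card := by
  obtain ⟨u, hu, h⟩ := hS.exists_mem_level_one hn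
  exact Finset.card_pos.2 ⟨u, Finset.mem_filter.2 ⟨hu, by omega⟩⟩

theorem IsTotalDomSetOn.two_le_card_filter {n : ℕ} (hn : 1 ≤ n) {S : Finset ℕ}
    (hS : IsTotalDomSetOn (hyperTree n) (treeVerts n) S) :
    2 ≤ (S.filter (· < 2 ^ 3)).card := by
  have hp : 2 ^ (1 + 1) ≤ 2 ^ (n + 1) := Nat.pow_le_pow_right (by norm_num) (by omega)
  obtain ⟨u, hu, h⟩ := hS.exists_mem_level_one hn
  obtain ⟨w, hw, hwu⟩ := hS.2 u (by simp only [treeVerts, Finset.mem_Icc]; omega)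
  have hw' := hyperTree_adj_cases (j := 0) (by omega) (by omega) hwu
  refine Finset.one_lt_card.2 ⟨u, Finset.mem_filter.2 ⟨hu, by omega⟩, w,
    Finset.mem_filter.2 ⟨hw, by omega⟩, hwu.ne'⟩

/-- Adding a full level `n + 2` extends a total dominating set of `HT(n)` to `HT(n + 3)`. -/
theorem IsTotalDomSetOn.union_Ico {n : ℕ} {S : Finset ℕ}
    (hS : IsTotalDomSetOn (hyperTree n) (treeVerts n) S) :
    IsTotalDomSetOn (hyperTree (n + 3)) (treeVerts (n + 3))
      (S ∪ Finset.Ico (2 ^ (n + 2)) (2 ^ (n + 3))) := by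
  have h0 : 0 < 2 ^ n := by positivity
  have e1 : 2 ^ (n + 1) = 2 * 2 ^ n := by ring
  have e2 : 2 ^ (n + 2) = 4 * 2 ^ n := by ring
  have e3 : 2 ^ (n + 3) = 8 * 2 ^ n := by ring
  have e4 : 2 ^ (n + 3 + 1) = 16 * 2 ^ n := by ring
  constructor
  · intro x hx
    rcases Finset.mem_union.1 hx with h | h
    · have := hS.1 h
      simp only [treeVerts, Finset.mem_Icc] at this ⊢
      omega
    · simp only [treeVerts, Finset.mem_Icc, Finset.mem_Ico] at h ⊢
      omega
  · intro v hv
    simp only [Finset.mem_union, Finset.mem_Ico]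
    simp only [treeVerts, Finset.mem_Icc] at hv
    by_cases h1 : v < 2 ^ (n + 1)
    · obtain ⟨u, hu, h⟩ := hS.2 v (by simp only [treeVerts, Finset.mem_Icc]; omega)
      exact ⟨u, Or.inl hu, hyperTree_mono (by omega) h⟩
    by_cases h2 : v < 2 ^ (n + 2)
    · exact ⟨2 * v, Or.inr (by omega),
        (hyperTree_adj_child (by omega) (Or.inl rfl) (by omega)).symm⟩
    by_cases h3 : v < 2 ^ (n + 3)
    · obtain ⟨u, hu, hu', h⟩ := exists_hyperTree_adj_level (n := n + 3) (i := n + 1)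
        (by omega) (le_of_not_gt h2) h3
      exact ⟨u, Or.inr ⟨hu, hu'⟩, h⟩
    · exact ⟨v / 2, Or.inr (by omega), hyperTree_adj_child (by omega) (by omega) (by omega)⟩

theorem exists_isTotalDomSetOn_add {r c C D : ℕ} (hc : 7 * c + D ≤ 2 ^ (r + 2) + C)
    (h : ∃ S, IsTotalDomSetOn (hyperTree r) (treeVerts r) S ∧ S.card ≤ c) (k : ℕ) :
    ∃ S, IsTotalDomSetOn (hyperTree (r + 3 * k)) (treeVerts (r + 3 * k)) S ∧
      7 * S.card + D ≤ 2 ^ (r + 3 * k + 2) + C := by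
  induction k with
  | zero =>
    obtain ⟨S, hS, hSc⟩ := h
    exact ⟨S, hS, by rw [Nat.mul_zero, Nat.add_zero]; omega⟩
  | succ k ih =>
    obtain ⟨S, hS, hSc⟩ := ih
    refine ⟨_, hS.union_Ico, ?_⟩
    have h1 := Finset.card_union_le S
      (Finset.Ico (2 ^ (r + 3 * k + 2)) (2 ^ (r + 3 * k + 3)))
    rw [Nat.card_Ico] at h1
    have e2 : 2 ^ (r + 3 * k + 3) = 2 * 2 ^ (r + 3 * k + 2) := by ring
    have e3 : 2 ^ (r + 3 * (k + 1) + 2) = 8 * 2 ^ (r + 3 * k + 2) := by ring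
    omega

theorem isTotalDomSetOn_hyperTree_one :
    IsTotalDomSetOn (hyperTree 1) (treeVerts 1) {1, 2} := by
  refine ⟨by decide, fun v hv => ?_⟩
  by_cases h : v = 1
  · subst h
    exact ⟨2, by simp, (hyperTree_adj_child le_rfl (by norm_num) (by norm_num)).symm⟩
  · simp only [treeVerts, Finset.mem_Icc] at hv
    exact ⟨1, by simp, hyperTree_adj_child le_rfl (by omega) (by omega)⟩

theorem isTotalDomSetOn_hyperTree_two :
    IsTotalDomSetOn (hyperTree 2) (treeVerts 2) {2, 3} := by
  have h23 : (hyperTree 2).Adj 2 3 := hyperTree_adj_level (i := 0) (by omega) le_rfl (by norm_num)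
  refine ⟨by decide, fun v hv => ?_⟩
  simp only [treeVerts, Finset.mem_Icc] at hv
  by_cases h1 : v = 1
  · subst h1
    exact ⟨2, by simp, (hyperTree_adj_child le_rfl (by norm_num) (by norm_num)).symm⟩
  by_cases h2 : v = 2
  · exact ⟨3, by simp, h2 ▸ h23.symm⟩
  by_cases h3 : v = 3
  · exact ⟨2, by simp, h3 ▸ h23⟩
  · refine ⟨v / 2, ?_, hyperTree_adj_child (by omega) (by omega) (by omega)⟩
    simp only [Finset.mem_insert, Finset.mem_singleton]
    omega

theorem isTotalDomSetOn_hyperTree_three :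
    IsTotalDomSetOn (hyperTree 3) (treeVerts 3) {2, 4, 5, 6, 7} := by
  refine ⟨by decide, fun v hv => ?_⟩
  simp only [treeVerts, Finset.mem_Icc] at hv
  simp only [Finset.mem_insert, Finset.mem_singleton]
  by_cases h1 : v < 4
  · exact ⟨2 * v, by omega, (hyperTree_adj_child (by omega) (Or.inl rfl) (by omega)).symm⟩
  by_cases h2 : v < 8
  · obtain ⟨u, hu, hu', h⟩ := exists_hyperTree_adj_level (n := 3) (i := 1) (x := v)
      (by omega) (by omega) (by omega)
    exact ⟨u, by omega, h⟩
  · exact ⟨v / 2, by omega, hyperTree_adj_child (by omega) (by omega) (by omega)⟩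

theorem totalDomNum_eq_of_forall_le {G : SimpleGraph ℕ} {V S : Finset ℕ} {m : ℕ}
    (hS : IsTotalDomSetOn G V S) (hSm : S.card ≤ m)
    (hm : ∀ T, IsTotalDomSetOn G V T → m ≤ T.card) : totalDomNum G V = m := by
  apply le_antisymm
  · refine le_trans (Nat.sInf_le ?_) hSm
    exact ⟨S, hS, rfl⟩
  · refine le_csInf ⟨S.card, S, hS, rfl⟩ ?_
    rintro _ ⟨T, hT, rfl⟩
    exact hm T hT

/-- The total domination number of the hypertree `HT(n)`, `n ≥ 1`. -/
theorem totalDomNum_hyperTree (n : ℕ) (hn : 1 ≤ n) :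
    (n % 3 = 0 → totalDomNum (hyperTree n) (treeVerts n) = (2 ^ (n + 2) + 3) / 7) ∧
    (n % 3 = 1 → totalDomNum (hyperTree n) (treeVerts n) = (2 ^ (n + 2) - 1) / 7 + 1) ∧
    (n % 3 = 2 → totalDomNum (hyperTree n) (treeVerts n) = 2 * (2 ^ (n + 1) - 1) / 7) := by
  refine ⟨fun h => ?_, fun h => ?_, fun h => ?_⟩
  · obtain ⟨k, rfl⟩ : ∃ k, n = 3 + 3 * k := ⟨n / 3 - 1, by omega⟩
    obtain ⟨S, hS, hSc⟩ := exists_isTotalDomSetOn_add (r := 3) (c := 5) (C := 3) (D := 0)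
      (by norm_num) ⟨_, isTotalDomSetOn_hyperTree_three, by decide⟩ k
    have lower : ∀ T, IsTotalDomSetOn (hyperTree (3 + 3 * k)) (treeVerts (3 + 3 * k)) T →
        2 ^ (3 + 3 * k + 2) + 3 ≤ 7 * T.card := fun T hT =>
      hT.pow_add_le_card (r := 1) (C := 3) (D := 0)
        (by have := hT.one_le_card_filter hn; norm_num at this ⊢; omega) (k + 1) (by ring)
    have := lower S hS
    exact totalDomNum_eq_of_forall_le hS (by omega) fun T hT => by have := lower T hT; omega
  · obtain ⟨k, rfl⟩ : ∃ k, n = 1 + 3 * k := ⟨n / 3, by omega⟩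
    have hp : 0 < 2 ^ (1 + 3 * k + 2) := by positivity
    obtain ⟨S, hS, hSc⟩ := exists_isTotalDomSetOn_add (r := 1) (c := 2) (C := 6) (D := 0)
      (by norm_num) ⟨_, isTotalDomSetOn_hyperTree_one, by decide⟩ k
    have lower : ∀ T, IsTotalDomSetOn (hyperTree (1 + 3 * k)) (treeVerts (1 + 3 * k)) T →
        2 ^ (1 + 3 * k + 2) + 6 ≤ 7 * T.card := fun T hT =>
      hT.pow_add_le_card (r := 2) (C := 6) (D := 0)
        (by have := hT.two_le_card_filter hn; norm_num at this ⊢; omega) k (by ring)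
    have := lower S hS
    exact totalDomNum_eq_of_forall_le hS (by omega) fun T hT => by have := lower T hT; omega
  · obtain ⟨k, rfl⟩ : ∃ k, n = 2 + 3 * k := ⟨n / 3, by omega⟩
    obtain ⟨S, hS, hSc⟩ := exists_isTotalDomSetOn_add (r := 2) (c := 2) (C := 0) (D := 2)
      (by norm_num) ⟨_, isTotalDomSetOn_hyperTree_two, by decide⟩ k
    have lower : ∀ T, IsTotalDomSetOn (hyperTree (2 + 3 * k)) (treeVerts (2 + 3 * k)) T →
        2 ^ (2 + 3 * k + 2) + 0 ≤ 7 * T.card + 2 := fun T hT =>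
      hT.pow_add_le_card (r := 0) (C := 0) (D := 2) (by omega) (k + 1) (by ring)
    have := lower S hS
    have e : 2 ^ (2 + 3 * k + 2) = 2 * 2 ^ (2 + 3 * k + 1) := by ring
    exact totalDomNum_eq_of_forall_le hS (by omega) fun T hT => by have := lower T hT; omega
end

section
/- Let G be the hypertree HT(n) with n ≥ 1. Then the locating-total domination number of G is γ^L_t(G) = (3·2^{n+1}+1)/7 if n ≡ 0 (mod 3), γ^L_t(G) = 2(3·2^{n}+1)/7 if n ≡ 1 (mod 3), and γ^L_t(G) = 3(2^{n+1}-1)/7 if n ≡ 2 (mod 3). -/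
namespace HyperTree

theorem mem_treeVerts {n x : ℕ} : x ∈ treeVerts n ↔ 1 ≤ x ∧ x < 2 * 2 ^ n := by
  have := Nat.two_pow_pos n
  rw [treeVerts, Finset.mem_Icc, pow_succ]
  omega

theorem level_unique {i j x : ℕ} (hi : 2 ^ i ≤ x) (hi' : x < 2 * 2 ^ i)
    (hj : 2 ^ j ≤ x) (hj' : x < 2 * 2 ^ j) : i = j := by
  rw [← pow_succ'] at hi' hj'
  have h1 := (Nat.pow_lt_pow_iff_right (a := 2) (by norm_num)).1 (hi.trans_lt hj')
  have h2 := (Nat.pow_lt_pow_iff_right (a := 2) (by norm_num)).1 (hj.trans_lt hi')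
  omega

theorem exists_level {x : ℕ} (hx : 1 ≤ x) : ∃ j, 2 ^ j ≤ x ∧ x < 2 * 2 ^ j := by
  refine ⟨Nat.log 2 x, Nat.pow_log_le_self 2 (by omega), ?_⟩
  rw [← pow_succ']
  exact Nat.lt_pow_succ_log_self (by norm_num) x

theorem level_le {n j x : ℕ} (hx : x < 2 * 2 ^ n) (hj : 2 ^ j ≤ x) : j ≤ n := by
  rw [← pow_succ'] at hx
  have := (Nat.pow_lt_pow_iff_right (a := 2) (by norm_num)).1 (hj.trans_lt hx)
  omega

/-- Adjacency to a vertex `y` at level `k + 1`. -/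
theorem adj_iff {n k x y : ℕ} (h1 : 2 * 2 ^ k ≤ y) (h2 : y < 4 * 2 ^ k) :
    (hyperTree n).Adj x y ↔ (1 ≤ x ∧ x < 2 * 2 ^ n ∧ y < 2 * 2 ^ n) ∧
      (y = 2 * x ∨ y = 2 * x + 1 ∨ x = 2 * y ∨ x = 2 * y + 1 ∨
        (y < 3 * 2 ^ k ∧ x = y + 2 ^ k) ∨ (3 * 2 ^ k ≤ y ∧ y = x + 2 ^ k)) := by
  have hk := Nat.two_pow_pos k
  have key : ∀ i, 1 ≤ i → 2 ^ i ≤ y → y < 2 ^ (i + 1) → 2 ^ (i - 1) = 2 ^ k := by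
    intro i hi h3 h4
    have := level_unique (i := i) (j := k + 1) h3 (by rw [pow_succ'] at h4; exact h4)
      (by rw [pow_succ']; exact h1) (by rw [pow_succ']; omega)
    subst this
    rfl
  have two : ∀ i, 1 ≤ i → 2 ^ i = 2 * 2 ^ (i - 1) ∧ 2 ^ (i + 1) = 4 * 2 ^ (i - 1) := by
    intro i hi
    obtain ⟨j, rfl⟩ : ∃ j, i = j + 1 := ⟨i - 1, by omega⟩
    simp only [Nat.add_sub_cancel, pow_succ]
    omega
  rw [hyperTree, SimpleGraph.fromRel_adj]
  simp only [mem_treeVerts]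
  constructor
  · rintro ⟨hne, ⟨hx, hy, h | h | ⟨i, hi, -, a, b, c, d, e⟩⟩ |
      ⟨hx, hy, h | h | ⟨i, hi, -, a, b, c, d, e⟩⟩⟩
    · omega
    · omega
    · have e1 := key i hi c d
      have e2 := two i hi
      omega
    · omega
    · omega
    · have e1 := key i hi a b
      have e2 := two i hi
      omega
  · rintro ⟨⟨hx, hx', hy⟩, h⟩
    have hkn : k + 1 ≤ n := level_le hy (by rw [pow_succ']; exact h1)
    have e2 := two (k + 1) (by omega)
    simp only [Nat.add_sub_cancel] at e2
    refine ⟨by omega, ?_⟩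
    rcases h with h | h | h | h | ⟨h, h'⟩ | ⟨h, h'⟩
    · exact Or.inl ⟨by omega, by omega, by omega⟩
    · exact Or.inl ⟨by omega, by omega, by omega⟩
    · exact Or.inr ⟨by omega, by omega, by omega⟩
    · exact Or.inr ⟨by omega, by omega, by omega⟩
    · exact Or.inr ⟨by omega, by omega, Or.inr (Or.inr ⟨k + 1, by omega, hkn, by omega, by omega,
        by omega, by omega, by simpa using h'⟩)⟩
    · exact Or.inl ⟨by omega, by omega, Or.inr (Or.inr ⟨k + 1, by omega, hkn, by omega, by omega,
        by omega, by omega, by simpa using h'⟩)⟩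

theorem adj_one {n x : ℕ} :
    (hyperTree n).Adj x 1 ↔ x < 2 * 2 ^ n ∧ (x = 2 ∨ x = 3) := by
  rw [SimpleGraph.adj_comm]
  have hn := Nat.two_pow_pos n
  constructor
  · intro h
    have hx : 2 ≤ x := by
      rw [hyperTree, SimpleGraph.fromRel_adj] at h
      simp only [mem_treeVerts] at h
      omega
    obtain ⟨j, h1, h2⟩ := exists_level (x := x) (by omega)
    rcases j with _ | k
    · simp at h2; omega
    · rw [pow_succ'] at h1 h2
      have := Nat.two_pow_pos k
      rw [adj_iff h1 (by omega)] at h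
      omega
  · rintro ⟨h, h'⟩
    rw [adj_iff (k := 0) (by omega) (by omega)]
    omega

section LowerBound

variable {n : ℕ} {S : Finset ℕ}

theorem exists_mem_adj (hS : IsLocTotalDomSetOn (hyperTree n) (treeVerts n) S) {k y : ℕ}
    (hk : k < n) (h1 : 2 * 2 ^ k ≤ y) (h2 : y < 4 * 2 ^ k) :
    ∃ x ∈ S, y = 2 * x ∨ y = 2 * x + 1 ∨ x = 2 * y ∨ x = 2 * y + 1 ∨
        (y < 3 * 2 ^ k ∧ x = y + 2 ^ k) ∨ (3 * 2 ^ k ≤ y ∧ y = x + 2 ^ k) := by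
  have hp := Nat.two_pow_pos k
  have : 2 ^ (k + 1) ≤ 2 ^ n := Nat.pow_le_pow_right (by norm_num) hk
  rw [pow_succ'] at this
  obtain ⟨x, hx, hxy⟩ := hS.1.2 y (mem_treeVerts.2 ⟨by omega, by omega⟩)
  exact ⟨x, hx, ((adj_iff h1 h2).1 hxy).2⟩

/-- Two unchosen siblings `y`, `y + 1` have a distinguishing neighbour in `S`, which is not
their parent. -/
theorem exists_mem_separating (hS : IsLocTotalDomSetOn (hyperTree n) (treeVerts n) S) {k c : ℕ}
    (hk : k < n) (h1 : 2 ^ k ≤ c) (h2 : c < 2 * 2 ^ k) (hu : 2 * c ∉ S) (hv : 2 * c + 1 ∉ S) :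
    ∃ x ∈ S, x ≠ c ∧ ∃ y, (y = 2 * c ∨ y = 2 * c + 1) ∧ (x = 2 * y ∨ x = 2 * y + 1 ∨
        (y < 3 * 2 ^ k ∧ x = y + 2 ^ k) ∨ (3 * 2 ^ k ≤ y ∧ y = x + 2 ^ k)) := by
  have hp := Nat.two_pow_pos k
  have : 2 ^ (k + 1) ≤ 2 ^ n := Nat.pow_le_pow_right (by norm_num) hk
  rw [pow_succ'] at this
  by_contra! hcon
  refine hS.2 (2 * c) (mem_treeVerts.2 ⟨by omega, by omega⟩) (2 * c + 1)
    (mem_treeVerts.2 ⟨by omega, by omega⟩) hu hv (by omega) ?_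
  ext x
  simp only [Set.mem_ofPred_eq]
  refine and_congr_right fun hx => ?_
  have hcx := hcon x hx
  rw [adj_iff (k := k) (by omega) (by omega), adj_iff (k := k) (by omega) (by omega)]
  by_cases hxc : x = c
  · subst hxc; omega
  · have a := hcx hxc (2 * c) (by omega)
    have b := hcx hxc (2 * c + 1) (by omega)
    omega

/-- The representative in the left half of level `k + 1` (with `M = 2 ^ k`) of the ancestor of a
vertex from levels `k + 1`, `k + 2`, `k + 3`. -/
def blockRep (M x : ℕ) : ℕ :=
  if x < 4 * M then (if x < 3 * M then x else x - M)
  else if x < 8 * M then (if x < 6 * M then x / 2 else x / 2 - M)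
  else (if x < 12 * M then x / 4 else x / 4 - M)

theorem blockRep_eq_of_mem {M c x : ℕ} (h1 : 2 * M ≤ c) (h2 : c < 3 * M)
    (h : x = c ∨ x = c + M ∨ x / 2 = c ∨ x / 2 = c + M ∨ x / 4 = c ∨ x / 4 = c + M) :
    blockRep M x = c := by
  unfold blockRep
  split_ifs <;> omega

theorem three_le_card {F : Finset ℕ} {a b c : ℕ} (ha : a ∈ F) (hb : b ∈ F) (hc : c ∈ F)
    (hab : a ≠ b) (hac : a ≠ c) (hbc : b ≠ c) : 3 ≤ F.card :=
  Finset.two_lt_card.2 ⟨a, ha, b, hb, c, hc, hab, hac, hbc⟩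

theorem three_le_card_block (hS : IsLocTotalDomSetOn (hyperTree n) (treeVerts n) S) {k c : ℕ}
    (hk : k + 1 < n) (h1 : 2 * 2 ^ k ≤ c) (h2 : c < 3 * 2 ^ k) {F : Finset ℕ}
    (hF : ∀ x ∈ S, (x = c ∨ x = c + 2 ^ k ∨ x / 2 = c ∨ x / 2 = c + 2 ^ k ∨
      x / 4 = c ∨ x / 4 = c + 2 ^ k) → x ∈ F) : 3 ≤ F.card := by
  have hpow : 2 ^ (k + 1) = 2 * 2 ^ k := pow_succ' 2 k
  have dom : ∀ y, 4 * 2 ^ k ≤ y → y < 8 * 2 ^ k → ∃ x ∈ S, y = 2 * x ∨ y = 2 * x + 1 ∨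
      x = 2 * y ∨ x = 2 * y + 1 ∨ (y < 6 * 2 ^ k ∧ x = y + 2 * 2 ^ k) ∨
      (6 * 2 ^ k ≤ y ∧ y = x + 2 * 2 ^ k) := by
    intro y hy hy'
    obtain ⟨x, hx, h⟩ := exists_mem_adj hS (k := k + 1) (y := y) hk (by omega) (by omega)
    exact ⟨x, hx, by omega⟩
  have left : ∀ y, y / 2 = c → ∃ x ∈ S, x = c ∨ x = y + 2 * 2 ^ k ∨ x / 2 = y := by
    intro y hy
    obtain ⟨x, hx, h⟩ := dom y (by omega) (by omega)
    exact ⟨x, hx, by omega⟩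
  have right : ∀ y, y / 2 = c → ∃ x ∈ S, x = c + 2 ^ k ∨ x = y ∨ x / 2 = y + 2 * 2 ^ k := by
    intro y hy
    obtain ⟨x, hx, h⟩ := dom (y + 2 * 2 ^ k) (by omega) (by omega)
    exact ⟨x, hx, by omega⟩
  clear dom
  obtain ⟨w, hw, hw'⟩ := left (2 * c) (by omega)
  obtain ⟨y, hy, hy'⟩ := right (2 * c) (by omega)
  by_cases hc : c ∈ S
  · by_cases hc' : c + 2 ^ k ∈ S
    · have fin : ∀ t ∈ S, t ≠ c → t ≠ c + 2 ^ k → (t / 2 = c ∨ t / 2 = c + 2 ^ k ∨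
          t / 4 = c ∨ t / 4 = c + 2 ^ k) → 3 ≤ F.card := fun t ht a b h =>
        three_le_card (hF _ hc (by omega)) (hF _ hc' (by omega)) (hF t ht (by omega))
          (by have := Nat.two_pow_pos k; omega) a.symm b.symm
      by_cases hu : 2 * c ∈ S
      · exact fin _ hu (by omega) (by omega) (by omega)
      by_cases hv : 2 * c + 1 ∈ S
      · exact fin _ hv (by omega) (by omega) (by omega)
      obtain ⟨t, ht, htc, s, hs, hst⟩ :=
        exists_mem_separating hS hk (c := c) (by omega) (by omega) hu hv
      exact fin t ht htc (by omega) (by omega)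
    · obtain ⟨z, hz, hz'⟩ := right (2 * c + 1) (by omega)
      have hyc : y ≠ c + 2 ^ k := fun h => hc' (h ▸ hy)
      have hzc : z ≠ c + 2 ^ k := fun h => hc' (h ▸ hz)
      exact three_le_card (hF w hw (by omega)) (hF y hy (by omega)) (hF z hz (by omega))
        (by omega) (by omega) (by omega)
  · obtain ⟨x, hx, hx'⟩ := left (2 * c + 1) (by omega)
    have hwc : w ≠ c := fun h => hc (h ▸ hw)
    have hxc : x ≠ c := fun h => hc (h ▸ hx)
    exact three_le_card (hF w hw (by omega)) (hF x hx (by omega)) (hF y hy (by omega))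
      (by omega) (by omega) (by omega)

/-- Levels `k + 1`, `k + 2`, `k + 3` together contain at least `3 * 2 ^ k` vertices of `S`. -/
theorem card_three_levels (hS : IsLocTotalDomSetOn (hyperTree n) (treeVerts n) S) {k : ℕ}
    (hk : k + 1 < n) :
    3 * 2 ^ k ≤ (S.filter fun x => 2 * 2 ^ k ≤ x ∧ x < 16 * 2 ^ k).card := by
  rw [Finset.card_eq_sum_card_fiberwise (f := blockRep (2 ^ k))
    (t := Finset.Ico (2 * 2 ^ k) (3 * 2 ^ k))]
  · have : (Finset.Ico (2 * 2 ^ k) (3 * 2 ^ k)).card = 2 ^ k := by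
      rw [Nat.card_Ico]; omega
    calc 3 * 2 ^ k = ∑ _c ∈ Finset.Ico (2 * 2 ^ k) (3 * 2 ^ k), 3 := by
          rw [Finset.sum_const, this, smul_eq_mul, mul_comm]
      _ ≤ _ := Finset.sum_le_sum fun c hc => by
          rw [Finset.mem_Ico] at hc
          refine three_le_card_block hS hk hc.1 hc.2 fun x hx h => ?_
          simp only [Finset.mem_filter]
          exact ⟨⟨hx, by omega, by omega⟩, blockRep_eq_of_mem hc.1 hc.2 h⟩
  · intro x hx
    simp only [Finset.coe_filter, Set.mem_ofPred_eq] at hx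
    simp only [Finset.coe_Ico, Set.mem_Ico, blockRep]
    split_ifs <;> omega

theorem card_levels_add (hS : IsLocTotalDomSetOn (hyperTree n) (treeVerts n) S) {m : ℕ}
    (hm : m + 3 ≤ n) :
    (S.filter (· < 2 ^ (m + 2))).card + 6 * 2 ^ m ≤ (S.filter (· < 2 ^ (m + 3 + 2))).card := by
  have h := card_three_levels hS (k := m + 1) (by omega)
  have e1 : 2 ^ (m + 1) = 2 * 2 ^ m := pow_succ' 2 m
  have e2 : 2 ^ (m + 2) = 4 * 2 ^ m := by rw [pow_succ', e1]; ring
  have e3 : 2 ^ (m + 3 + 2) = 32 * 2 ^ m := by ring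
  have hd : Disjoint (S.filter (· < 2 ^ (m + 2)))
      (S.filter fun x => 2 * 2 ^ (m + 1) ≤ x ∧ x < 16 * 2 ^ (m + 1)) :=
    Finset.disjoint_filter.2 fun x _ h1 h2 => by omega
  have hsub : S.filter (· < 2 ^ (m + 2)) ∪
      S.filter (fun x => 2 * 2 ^ (m + 1) ≤ x ∧ x < 16 * 2 ^ (m + 1)) ⊆
      S.filter (· < 2 ^ (m + 3 + 2)) := by
    intro x hx
    simp only [Finset.mem_union, Finset.mem_filter] at hx ⊢
    rcases hx with ⟨hx, h⟩ | ⟨hx, h⟩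
    · exact ⟨hx, by omega⟩
    · exact ⟨hx, by omega⟩
  have := Finset.card_le_card hsub
  rw [Finset.card_union_of_disjoint hd] at this
  omega

theorem one_le_card_top (hS : IsLocTotalDomSetOn (hyperTree n) (treeVerts n) S) :
    1 ≤ (S.filter (· < 2 ^ 2)).card := by
  have hn := Nat.two_pow_pos n
  obtain ⟨x, hx, h⟩ := hS.1.2 1 (mem_treeVerts.2 (by omega))
  rw [adj_one] at h
  exact Finset.card_pos.2 ⟨x, Finset.mem_filter.2 ⟨hx, by omega⟩⟩

theorem two_le_card_top (hn : 1 ≤ n) (hS : IsLocTotalDomSetOn (hyperTree n) (treeVerts n) S) :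
    2 ≤ (S.filter (· < 2 ^ 3)).card := by
  have hn' := Nat.two_pow_pos n
  obtain ⟨x, hx, h⟩ := hS.1.2 1 (mem_treeVerts.2 (by omega))
  rw [adj_one] at h
  obtain ⟨y, hy, h'⟩ := exists_mem_adj hS (k := 0) (y := x) (by omega) (by omega) (by omega)
  exact Finset.one_lt_card.2 ⟨x, Finset.mem_filter.2 ⟨hx, by omega⟩, y,
    Finset.mem_filter.2 ⟨hy, by omega⟩, by omega⟩

theorem three_le_card_top (hn : 2 ≤ n) (hS : IsLocTotalDomSetOn (hyperTree n) (treeVerts n) S) :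
    3 ≤ (S.filter (· < 2 ^ 4)).card := by
  refine (card_three_levels hS (k := 0) (by omega)).trans
    (Finset.card_le_card fun x hx => ?_)
  simp only [Finset.mem_filter] at hx ⊢
  exact ⟨hx.1, by omega⟩

theorem le_card_levels (hS : IsLocTotalDomSetOn (hyperTree n) (treeVerts n) S) (hn : 1 ≤ n) :
    ∀ m ≤ n,
      (m % 3 = 0 → 6 * 2 ^ m + 1 ≤ 7 * (S.filter (· < 2 ^ (m + 2))).card) ∧
      (m % 3 = 1 → 6 * 2 ^ m + 2 ≤ 7 * (S.filter (· < 2 ^ (m + 2))).card) ∧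
      (m % 3 = 2 → 6 * 2 ^ m ≤ 7 * (S.filter (· < 2 ^ (m + 2))).card + 3) := by
  intro m
  induction m using Nat.strong_induction_on with
  | _ m ih =>
    intro hm
    match m, ih, hm with
    | 0, _, _ =>
      have : 1 ≤ (S.filter (· < 2 ^ (0 + 2))).card := one_le_card_top hS
      omega
    | 1, _, _ =>
      have : 2 ≤ (S.filter (· < 2 ^ (1 + 2))).card := two_le_card_top hn hS
      omega
    | 2, _, hm =>
      have : 3 ≤ (S.filter (· < 2 ^ (2 + 2))).card := three_le_card_top hm hS
      omega
    | m + 3, ih, hm =>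
      have h := ih m (by omega) (by omega)
      have h' := card_levels_add hS hm
      have e : 2 ^ (m + 3) = 8 * 2 ^ m := by ring
      rw [e]
      omega

theorem le_card (hS : IsLocTotalDomSetOn (hyperTree n) (treeVerts n) S) (hn : 1 ≤ n) :
    (n % 3 = 0 → 6 * 2 ^ n + 1 ≤ 7 * S.card) ∧ (n % 3 = 1 → 6 * 2 ^ n + 2 ≤ 7 * S.card) ∧
      (n % 3 = 2 → 6 * 2 ^ n ≤ 7 * S.card + 3) := by
  have h := le_card_levels hS hn n le_rfl
  have h' := Finset.card_filter_le S (· < 2 ^ (n + 2))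
  omega

end LowerBound

section UpperBound

/-- The vertices at levels congruent to `n - 1` modulo `3`, together with the even vertices in the
left half of the levels congruent to `n` modulo `3`. -/
def periodicSet (n : ℕ) : Finset ℕ :=
  (treeVerts n).filter fun x => (n - Nat.log 2 x) % 3 = 1 ∨
    ((n - Nat.log 2 x) % 3 = 0 ∧ x % 2 = 0 ∧ 2 * x < 3 * 2 ^ Nat.log 2 x)

/-- An optimal locating-total dominating set of `HT(n)`. -/
def optimalSet (n : ℕ) : Finset ℕ :=
  periodicSet n ∪ if n % 3 = 0 then {2} else ∅

theorem mem_periodicSet {n j x : ℕ} (h1 : 2 ^ j ≤ x) (h2 : x < 2 * 2 ^ j) :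
    x ∈ periodicSet n ↔ j ≤ n ∧ ((n - j) % 3 = 1 ∨
      ((n - j) % 3 = 0 ∧ x % 2 = 0 ∧ 2 * x < 3 * 2 ^ j)) := by
  have hj := Nat.two_pow_pos j
  have hlog : Nat.log 2 x = j :=
    (Nat.log_eq_iff (Or.inr ⟨by norm_num, by omega⟩)).2 ⟨h1, by rw [pow_succ']; exact h2⟩
  have hle : x < 2 * 2 ^ n ↔ j ≤ n := by
    refine ⟨fun h => level_le h h1, fun h => ?_⟩
    have : 2 ^ j ≤ 2 ^ n := Nat.pow_le_pow_right (by norm_num) h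
    omega
  rw [periodicSet, Finset.mem_filter, mem_treeVerts, hlog, hle]
  omega

theorem mem_optimalSet {n j x : ℕ} (h1 : 2 ^ j ≤ x) (h2 : x < 2 * 2 ^ j) :
    x ∈ optimalSet n ↔ (j ≤ n ∧ ((n - j) % 3 = 1 ∨
      ((n - j) % 3 = 0 ∧ x % 2 = 0 ∧ 2 * x < 3 * 2 ^ j))) ∨ (n % 3 = 0 ∧ x = 2) := by
  rw [optimalSet, Finset.mem_union, mem_periodicSet h1 h2]
  split_ifs with h <;> simp [h]

theorem card_periodicSet_add_three (n : ℕ) :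
    (periodicSet (n + 3)).card ≤ (periodicSet n).card + 6 * 2 ^ n := by
  have hn := Nat.two_pow_pos n
  have hsub : periodicSet (n + 3) ⊆ (periodicSet n ∪ Finset.Ico (4 * 2 ^ n) (8 * 2 ^ n)) ∪
      (Finset.Ico (4 * 2 ^ n) (6 * 2 ^ n)).image (2 * ·) := by
    intro x hx
    have hxV := mem_treeVerts.1 (Finset.mem_filter.1 hx).1
    obtain ⟨j, h1, h2⟩ := exists_level hxV.1
    rw [mem_periodicSet h1 h2] at hx
    simp only [Finset.mem_union, Finset.mem_image, Finset.mem_Ico, mem_periodicSet h1 h2]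
    by_cases hj : j ≤ n
    · left; left; omega
    · obtain rfl | rfl | rfl : j = n + 1 ∨ j = n + 2 ∨ j = n + 3 := by omega
      · omega
      · left; right
        rw [show 2 ^ (n + 2) = 4 * 2 ^ n by ring] at h1 h2
        omega
      · right
        rw [show 2 ^ (n + 3) = 8 * 2 ^ n by ring] at h1 h2 hx
        exact ⟨x / 2, by omega, by omega⟩
  have h1 := Finset.card_le_card hsub
  have h2 := Finset.card_union_le (periodicSet n ∪ Finset.Ico (4 * 2 ^ n) (8 * 2 ^ n))
    ((Finset.Ico (4 * 2 ^ n) (6 * 2 ^ n)).image (2 * ·))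
  have h3 := Finset.card_union_le (periodicSet n) (Finset.Ico (4 * 2 ^ n) (8 * 2 ^ n))
  have h4 : ((Finset.Ico (4 * 2 ^ n) (6 * 2 ^ n)).image (2 * ·)).card ≤ _ :=
    Finset.card_image_le
  rw [Nat.card_Ico] at h3 h4
  omega

theorem card_periodicSet_le (n : ℕ) :
    (n % 3 = 0 → 7 * (periodicSet n).card + 6 ≤ 6 * 2 ^ n) ∧
    (n % 3 = 1 → 7 * (periodicSet n).card ≤ 6 * 2 ^ n + 2) ∧
    (n % 3 = 2 → 7 * (periodicSet n).card + 3 ≤ 6 * 2 ^ n) := by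
  induction n using Nat.strong_induction_on with
  | _ n ih =>
    match n, ih with
    | 0, _ =>
      have : (periodicSet 0).card = 0 := by decide +kernel
      omega
    | 1, _ =>
      have : (periodicSet 1).card = 2 := by decide +kernel
      omega
    | 2, _ =>
      have : (periodicSet 2).card = 3 := by decide +kernel
      omega
    | n + 3, ih =>
      have h := ih n (by omega)
      have h' := card_periodicSet_add_three n
      have e : 2 ^ (n + 3) = 8 * 2 ^ n := by ring
      rw [e]
      omega

theorem card_optimalSet_le (n : ℕ) :
    (n % 3 = 0 → 7 * (optimalSet n).card ≤ 6 * 2 ^ n + 1) ∧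
    (n % 3 = 1 → 7 * (optimalSet n).card ≤ 6 * 2 ^ n + 2) ∧
    (n % 3 = 2 → 7 * (optimalSet n).card + 3 ≤ 6 * 2 ^ n) := by
  have h := card_periodicSet_le n
  have h' := Finset.card_union_le (periodicSet n) (if n % 3 = 0 then {2} else ∅)
  rw [← optimalSet] at h'
  split_ifs at h' with h0
  · rw [Finset.card_singleton] at h'
    omega
  · rw [Finset.card_empty] at h'
    omega

variable {n : ℕ}

theorem optimalSet_subset (hn : 1 ≤ n) : optimalSet n ⊆ treeVerts n := by
  have h2 : 2 ^ 1 ≤ 2 ^ n := Nat.pow_le_pow_right (by norm_num) hn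
  refine Finset.union_subset (Finset.filter_subset _ _) ?_
  split_ifs
  · rw [Finset.singleton_subset_iff, mem_treeVerts]
    omega
  · exact Finset.empty_subset _

theorem optimalSet_isTotalDomSetOn (hn : 1 ≤ n) :
    IsTotalDomSetOn (hyperTree n) (treeVerts n) (optimalSet n) := by
  refine ⟨optimalSet_subset hn, fun v hv => ?_⟩
  rw [mem_treeVerts] at hv
  obtain ⟨j, h1, h2⟩ := exists_level hv.1
  have hjn := level_le hv.2 h1
  rcases j with _ | k
  · obtain rfl : v = 1 := by simp at h1 h2; omega
    have hp : 2 ^ 1 ≤ 2 ^ n := Nat.pow_le_pow_right (by norm_num) hn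
    refine ⟨2, ?_, adj_one.2 (by omega)⟩
    rw [mem_optimalSet (j := 1) (by omega) (by omega)]
    omega
  · have e : 2 ^ (k + 1) = 2 * 2 ^ k := pow_succ' 2 k
    have hk := Nat.two_pow_pos k
    have hkn : 2 ^ (k + 1) ≤ 2 ^ n := Nat.pow_le_pow_right (by norm_num) hjn
    obtain h | h | h : (n - (k + 1)) % 3 = 0 ∨ (n - (k + 1)) % 3 = 1 ∨ (n - (k + 1)) % 3 = 2 := by
      omega
    · refine ⟨v / 2, ?_, ?_⟩
      · rw [mem_optimalSet (j := k) (by omega) (by omega)]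
        omega
      · rw [adj_iff (k := k) (by omega) (by omega)]
        omega
    · refine ⟨if v < 3 * 2 ^ k then v + 2 ^ k else v - 2 ^ k, ?_, ?_⟩
      · rw [mem_optimalSet (j := k + 1) (by split_ifs <;> omega) (by split_ifs <;> omega)]
        omega
      · rw [adj_iff (k := k) (by omega) (by omega)]
        split_ifs <;> omega
    · have hkn' : 2 ^ (k + 2) ≤ 2 ^ n := Nat.pow_le_pow_right (by norm_num) (by omega)
      have e' : 2 ^ (k + 2) = 4 * 2 ^ k := by ring
      refine ⟨2 * v, ?_, ?_⟩
      · rw [mem_optimalSet (j := k + 2) (by omega) (by omega)]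
        omega
      · rw [adj_iff (k := k) (by omega) (by omega)]
        omega

/-- A vertex with both children in `S` is determined by its trace on `S`. -/
theorem eq_of_adj_children {u v : ℕ} (hu : 1 ≤ u) (h : (hyperTree n).Adj (2 * u) v)
    (h' : (hyperTree n).Adj (2 * u + 1) v) : u = v := by
  obtain ⟨j, h1, h2⟩ := exists_level hu
  rw [SimpleGraph.adj_comm, adj_iff (k := j) (by omega) (by omega)] at h h'
  omega

theorem adj_children {u : ℕ} (hu : 1 ≤ u) (h : 2 * u + 1 < 2 * 2 ^ n) :
    (hyperTree n).Adj (2 * u) u ∧ (hyperTree n).Adj (2 * u + 1) u := by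
  obtain ⟨j, h1, h2⟩ := exists_level hu
  rw [SimpleGraph.adj_comm, adj_iff (k := j) (by omega) (by omega), SimpleGraph.adj_comm,
    adj_iff (k := j) (by omega) (by omega)]
  omega

theorem eq_of_trace_eq_of_mod_two {j u v : ℕ} (h1 : 2 ^ j ≤ u) (h2 : u < 2 * 2 ^ j)
    (hjn : j ≤ n) (hj : (n - j) % 3 = 2)
    (heq : {w : ℕ | w ∈ optimalSet n ∧ (hyperTree n).Adj w u} =
      {w : ℕ | w ∈ optimalSet n ∧ (hyperTree n).Adj w v}) : u = v := by
  have hp := Nat.two_pow_pos j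
  have e : 2 ^ (j + 1) = 2 * 2 ^ j := pow_succ' 2 j
  have hpn : 2 ^ (j + 1) ≤ 2 ^ n := Nat.pow_le_pow_right (by norm_num) (by omega)
  have hadj := adj_children (n := n) (u := u) (by omega) (by omega)
  have m1 : 2 * u ∈ optimalSet n := by
    rw [mem_optimalSet (j := j + 1) (by omega) (by omega)]; omega
  have m2 : 2 * u + 1 ∈ optimalSet n := by
    rw [mem_optimalSet (j := j + 1) (by omega) (by omega)]; omega
  exact eq_of_adj_children (by omega) ((Set.ext_iff.1 heq _).1 ⟨m1, hadj.1⟩).2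
    ((Set.ext_iff.1 heq _).1 ⟨m2, hadj.2⟩).2

theorem trace_ne_of_siblings {k p : ℕ} (h1 : 2 ^ k ≤ p) (h2 : p < 2 * 2 ^ k)
    (hkn : k + 1 ≤ n) (hk : (n - (k + 1)) % 3 = 0) (hu : 2 * p ∉ optimalSet n) :
    {w : ℕ | w ∈ optimalSet n ∧ (hyperTree n).Adj w (2 * p)} ≠
      {w : ℕ | w ∈ optimalSet n ∧ (hyperTree n).Adj w (2 * p + 1)} := by
  intro heq
  have hp := Nat.two_pow_pos k
  have e : 2 ^ (k + 1) = 2 * 2 ^ k := pow_succ' 2 k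
  have hpn : 2 ^ (k + 1) ≤ 2 ^ n := Nat.pow_le_pow_right (by norm_num) (by omega)
  rw [mem_optimalSet (j := k + 1) (by omega) (by omega)] at hu
  have hev : 2 ^ k % 2 = 0 := by
    rcases k with _ | k
    · simp at h1 h2; omega
    · rw [pow_succ]; omega
  have hm : 2 * p - 2 ^ k ∈ optimalSet n := by
    rw [mem_optimalSet (j := k + 1) (by omega) (by omega)]
    omega
  have ha : (hyperTree n).Adj (2 * p - 2 ^ k) (2 * p) := by
    rw [adj_iff (k := k) (by omega) (by omega)]
    omega
  have hb := ((Set.ext_iff.1 heq _).1 ⟨hm, ha⟩).2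
  rw [adj_iff (k := k) (by omega) (by omega)] at hb
  omega

/-- If `u ∉ S` is at a positive level congruent to `n`, every other `v ∉ S` that also is at a
level congruent to `n` has a different trace on `S`. -/
theorem trace_ne_of_mod_zero {k j u v : ℕ} (h1 : 2 * 2 ^ k ≤ u) (h2 : u < 4 * 2 ^ k)
    (hkn : k + 1 ≤ n) (hk : (n - (k + 1)) % 3 = 0) (h3 : 2 ^ j ≤ v) (h4 : v < 2 * 2 ^ j)
    (hjn : j ≤ n) (hj : (n - j) % 3 = 0) (hu : u ∉ optimalSet n) (hv : v ∉ optimalSet n)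
    (hne : u ≠ v) :
    {w : ℕ | w ∈ optimalSet n ∧ (hyperTree n).Adj w u} ≠
      {w : ℕ | w ∈ optimalSet n ∧ (hyperTree n).Adj w v} := by
  intro heq
  have e : 2 ^ (k + 1) = 2 * 2 ^ k := pow_succ' 2 k
  have hp := Nat.two_pow_pos k
  have hpn : 2 ^ (k + 1) ≤ 2 ^ n := Nat.pow_le_pow_right (by norm_num) hkn
  have hm : u / 2 ∈ optimalSet n := by
    rw [mem_optimalSet (j := k) (by omega) (by omega)]; omega
  have ha : (hyperTree n).Adj (u / 2) u := by
    rw [adj_iff (k := k) (by omega) (by omega)]; omega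
  have hb := ((Set.ext_iff.1 heq _).1 ⟨hm, ha⟩).2
  have hsib : v / 2 = u / 2 := by
    rw [SimpleGraph.adj_comm] at hb
    rcases k with _ | i
    · have : u / 2 = 1 := by simp at h1 h2; omega
      rw [this, adj_one] at hb
      omega
    · have e' : 2 ^ (i + 1) = 2 * 2 ^ i := pow_succ' 2 i
      rw [adj_iff (k := i) (by omega) (by omega)] at hb
      by_contra hcon
      obtain h | h : u / 2 / 2 = v ∨ (2 * 2 ^ i ≤ v ∧ v < 4 * 2 ^ i) := by omega
      · have := level_unique (i := i) (j := j) (x := v) (by omega) (by omega) h3 h4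
        omega
      · have := level_unique (i := i + 1) (j := j) (x := v) (by omega) (by omega) h3 h4
        omega
  obtain ⟨p, rfl, rfl⟩ | ⟨p, rfl, rfl⟩ :
      (∃ p, u = 2 * p ∧ v = 2 * p + 1) ∨ ∃ p, v = 2 * p ∧ u = 2 * p + 1 := by
    by_cases h : u < v
    · exact Or.inl ⟨u / 2, by omega, by omega⟩
    · exact Or.inr ⟨u / 2, by omega, by omega⟩
  · exact trace_ne_of_siblings (by omega) (by omega) hkn hk hu heq
  · exact trace_ne_of_siblings (by omega) (by omega) hkn hk hv heq.symm

theorem optimalSet_locatesOn : LocatesOn (hyperTree n) (treeVerts n) (optimalSet n) := by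
  intro u huV v hvV hu hv hne heq
  rw [mem_treeVerts] at huV hvV
  obtain ⟨i, h1, h2⟩ := exists_level huV.1
  obtain ⟨j, h3, h4⟩ := exists_level hvV.1
  have hin := level_le huV.2 h1
  have hjn := level_le hvV.2 h3
  have hu' := hu
  have hv' := hv
  rw [mem_optimalSet h1 h2] at hu'
  rw [mem_optimalSet h3 h4] at hv'
  by_cases hi : (n - i) % 3 = 2
  · exact hne (eq_of_trace_eq_of_mod_two h1 h2 hin hi heq)
  by_cases hj : (n - j) % 3 = 2
  · exact hne (eq_of_trace_eq_of_mod_two h3 h4 hjn hj heq.symm).symm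
  rcases i with _ | i
  · rcases j with _ | j
    · simp at h1 h2 h3 h4; omega
    · rw [pow_succ'] at h3 h4
      exact trace_ne_of_mod_zero h3 (by omega) hjn (by omega) h1 h2 hin (by omega) hv hu
        hne.symm heq.symm
  · rw [pow_succ'] at h1 h2
    exact trace_ne_of_mod_zero h1 (by omega) hin (by omega) h3 h4 hjn (by omega) hu hv hne heq

end UpperBound

theorem locTotalDomNum_bounds {n : ℕ} (hn : 1 ≤ n) :
    let k := locTotalDomNum (hyperTree n) (treeVerts n)
    (n % 3 = 0 → 7 * k = 6 * 2 ^ n + 1) ∧ (n % 3 = 1 → 7 * k = 6 * 2 ^ n + 2) ∧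
      (n % 3 = 2 → 7 * k + 3 = 6 * 2 ^ n) := by
  intro k
  have hopt : IsLocTotalDomSetOn (hyperTree n) (treeVerts n) (optimalSet n) :=
    ⟨optimalSet_isTotalDomSetOn hn, optimalSet_locatesOn⟩
  have hle : k ≤ (optimalSet n).card := Nat.sInf_le ⟨optimalSet n, hopt, rfl⟩
  obtain ⟨S, hS, hSk⟩ : ∃ S : Finset ℕ,
      IsLocTotalDomSetOn (hyperTree n) (treeVerts n) S ∧ S.card = k :=
    Nat.sInf_mem (s := {k | ∃ S : Finset ℕ,
      IsLocTotalDomSetOn (hyperTree n) (treeVerts n) S ∧ S.card = k}) ⟨_, optimalSet n, hopt, rfl⟩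
  have h1 := le_card hS hn
  have h2 := card_optimalSet_le n
  omega

end HyperTree

/-- The locating-total domination number of the hypertree `HT(n)`, `n ≥ 1`. -/
theorem locTotalDomNum_hyperTree (n : ℕ) (hn : 1 ≤ n) :
    (n % 3 = 0 → locTotalDomNum (hyperTree n) (treeVerts n) = (3 * 2 ^ (n + 1) + 1) / 7) ∧
    (n % 3 = 1 → locTotalDomNum (hyperTree n) (treeVerts n) = 2 * (3 * 2 ^ n + 1) / 7) ∧
    (n % 3 = 2 → locTotalDomNum (hyperTree n) (treeVerts n) = 3 * (2 ^ (n + 1) - 1) / 7) := by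
  have h := HyperTree.locTotalDomNum_bounds hn
  rw [pow_succ']
  omega
end

section
/- Let G be the sibling tree ST_n with n ≥ 1. Then the domination number of G is γ(G) = (2^{n+2}+3)/7 if n ≡ 0 (mod 3), γ(G) = (2^{n+2}-1)/7 if n ≡ 1 (mod 3), and γ(G) = 2(2^{n+1}-1)/7 if n ≡ 2 (mod 3). -/
theorem siblingTree_adj_iff {n u v : ℕ} :
    (siblingTree n).Adj u v ↔ u ≠ v ∧ u ∈ treeVerts n ∧ v ∈ treeVerts n ∧
      (v = 2 * u ∨ v = 2 * u + 1 ∨ u = 2 * v ∨ u = 2 * v + 1 ∨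
        (2 ∣ u ∧ v = u + 1) ∨ (2 ∣ v ∧ u = v + 1)) := by
  have sibling_iff (x y : ℕ) : (∃ p, x = 2 * p ∧ y = 2 * p + 1) ↔ 2 ∣ x ∧ y = x + 1 :=
    ⟨fun ⟨p, hx, hy⟩ => by omega, fun h => ⟨x / 2, by omega, by omega⟩⟩
  simp only [siblingTree, SimpleGraph.fromRel_adj, sibling_iff]
  tauto

theorem mem_treeVerts {n x : ℕ} : x ∈ treeVerts n ↔ x ≠ 0 ∧ x < 2 ^ (n + 1) := by
  have := Nat.two_pow_pos (n + 1)
  simp only [treeVerts, Finset.mem_Icc]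
  omega

theorem log_two_mul_add_one {x : ℕ} (hx : x ≠ 0) : Nat.log 2 (2 * x + 1) = Nat.log 2 x + 1 := by
  rw [Nat.log_of_one_lt_of_le one_lt_two (by omega)]
  congr 2
  omega

theorem log_two_mul {x : ℕ} (hx : x ≠ 0) : Nat.log 2 (2 * x) = Nat.log 2 x + 1 := by
  rw [mul_comm, Nat.log_mul_base one_lt_two hx]

/-- The vertices of `ST_n` on the levels congruent to `n - 1` modulo `3`, together with the
non-vertex `0`, standing for the parent of the root, when `3` divides `n`. -/
def parentLevels (n : ℕ) : Finset ℕ :=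
  {x ∈ Finset.range (2 ^ n) | if x = 0 then n % 3 = 0 else (Nat.log 2 x + 1) % 3 = n % 3}

theorem mem_parentLevels {n x : ℕ} : x ∈ parentLevels n ↔ x < 2 ^ n ∧
    (x = 0 ∧ n % 3 = 0 ∨ x ≠ 0 ∧ (Nat.log 2 x + 1) % 3 = n % 3) := by
  simp only [parentLevels, Finset.mem_filter, Finset.mem_range]
  split_ifs <;> simp [*]

theorem parentLevels_add_three (n : ℕ) : parentLevels (n + 3) =
    parentLevels n ∪ Finset.Ico (2 ^ (n + 2)) (2 ^ (n + 3)) := by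
  ext x
  simp only [Finset.mem_union, mem_parentLevels, Finset.mem_Ico]
  have hpos := Nat.two_pow_pos n
  rcases eq_or_ne x 0 with rfl | hx
  · simp
  · have h0 := Nat.log_lt_iff_lt_pow (x := n) one_lt_two hx
    have h2 := Nat.log_lt_iff_lt_pow (x := n + 2) one_lt_two hx
    have h3 := Nat.log_lt_iff_lt_pow (x := n + 3) one_lt_two hx
    rw [← h0, ← h3, ← not_lt, ← h2]
    omega

theorem card_parentLevels_add_three (n : ℕ) :
    (parentLevels (n + 3)).card = (parentLevels n).card + 2 ^ (n + 2) := by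
  have hpow2 : 2 ^ (n + 2) = 4 * 2 ^ n := by ring
  have hpow3 : 2 ^ (n + 3) = 8 * 2 ^ n := by ring
  rw [parentLevels_add_three, Finset.card_union_of_disjoint, Nat.card_Ico]
  · omega
  · rw [Finset.disjoint_left]
    intro x hx hx'
    have := (mem_parentLevels.1 hx).1
    have := (Finset.mem_Ico.1 hx').1
    omega

theorem card_parentLevels (n : ℕ) :
    (n % 3 = 0 → 7 * (parentLevels n).card = 2 ^ (n + 2) + 3) ∧
    (n % 3 = 1 → 7 * (parentLevels n).card + 1 = 2 ^ (n + 2)) ∧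
    (n % 3 = 2 → 7 * (parentLevels n).card + 2 = 2 ^ (n + 2)) := by
  induction n using Nat.strong_induction_on with
  | _ n ih =>
    match n, ih with
    | 0, _ => decide
    | 1, _ => decide
    | 2, _ => decide
    | n + 3, ih =>
      have := ih n (by omega)
      have hpow : 2 ^ (n + 3 + 2) = 8 * 2 ^ (n + 2) := by ring
      rw [card_parentLevels_add_three]
      omega

/-- A dominating set meets each of the disjoint closed neighbourhoods of the vertices `2 * d`,
for `d` in `parentLevels n` (the root if `d = 0`). -/
theorem card_parentLevels_le {n : ℕ} {S : Finset ℕ}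
    (hS : IsDomSetOn (siblingTree n) (treeVerts n) S) : (parentLevels n).card ≤ S.card := by
  let g : ℕ → ℕ := fun u =>
    if (Nat.log 2 u + 1) % 3 = n % 3 then u else if Nat.log 2 u % 3 = n % 3 then u / 2 else u / 4
  refine Finset.card_le_card_of_surjOn g fun d hd => ?_
  obtain ⟨hdn, hd⟩ := mem_parentLevels.1 (Finset.mem_coe.1 hd)
  have hpow : 2 ^ (n + 1) = 2 * 2 ^ n := by ring
  obtain ⟨u, hu, hnbr⟩ : ∃ u ∈ S, u = max (2 * d) 1 ∨ (siblingTree n).Adj u (max (2 * d) 1) := by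
    by_cases hw : max (2 * d) 1 ∈ S
    · exact ⟨_, hw, Or.inl rfl⟩
    · obtain ⟨u, hu, h⟩ := hS.2 _ (mem_treeVerts.2 (by omega)) hw
      exact ⟨u, hu, Or.inr h⟩
  have hu0 : u ≠ 0 := (mem_treeVerts.1 (hS.1 hu)).1
  refine ⟨u, hu, ?_⟩
  rw [siblingTree_adj_iff] at hnbr
  rcases hd with ⟨rfl, hn⟩ | ⟨hd0, hd⟩
  · have : u = 1 ∨ u = 2 ∨ u = 3 := by omega
    have h2 : Nat.log 2 2 = 1 := by decide
    have h3 : Nat.log 2 3 = 1 := by decide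
    rcases this with rfl | rfl | rfl <;> simp [g, h2, h3, hn]
  · have hl := log_two_mul hd0
    have hl' := log_two_mul_add_one hd0
    have hll := log_two_mul (x := 2 * d) (by omega)
    have hll' := log_two_mul_add_one (x := 2 * d) (by omega)
    have : u = d ∨ u = 2 * d ∨ u = 2 * d + 1 ∨ u = 2 * (2 * d) ∨ u = 2 * (2 * d) + 1 := by omega
    simp only [g]
    rcases this with rfl | rfl | rfl | rfl | rfl <;> split_ifs <;> omega

theorem isDomSetOn_image_parentLevels {n : ℕ} (hn : 1 ≤ n) :
    IsDomSetOn (siblingTree n) (treeVerts n) ((parentLevels n).image (max 1)) := by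
  have hpow : 2 ^ (n + 1) = 2 * 2 ^ n := by ring
  have hpos := Nat.two_pow_pos n
  have mem_image {d : ℕ} (hd0 : d ≠ 0) (hdn : d < 2 ^ n) (hd : (Nat.log 2 d + 1) % 3 = n % 3) :
      d ∈ (parentLevels n).image (max 1) :=
    Finset.mem_image.2 ⟨d, mem_parentLevels.2 ⟨hdn, Or.inr ⟨hd0, hd⟩⟩, by omega⟩
  constructor
  · intro x hx
    obtain ⟨d, hd, rfl⟩ := Finset.mem_image.1 hx
    have := (mem_parentLevels.1 hd).1
    exact mem_treeVerts.2 (by omega)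
  · intro v hv hvS
    obtain ⟨hv0, hvn⟩ := mem_treeVerts.1 hv
    have hlog := (Nat.log_lt_iff_lt_pow (x := n + 1) one_lt_two hv0).2 hvn
    have hlogn := Nat.log_lt_iff_lt_pow (x := n) one_lt_two hv0
    have hlogn' := Nat.log_lt_iff_lt_pow (x := n - 1) one_lt_two hv0
    have hpow' : 2 ^ n = 2 * 2 ^ (n - 1) := by rw [← pow_succ', Nat.sub_add_cancel hn]
    by_cases h : (Nat.log 2 v + 1) % 3 = n % 3
    · exact absurd (mem_image hv0 (by omega) h) hvS
    by_cases h' : Nat.log 2 v % 3 = n % 3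
    · have hv1 : v ≠ 1 := by
        rintro rfl
        refine hvS (Finset.mem_image.2 ⟨0, mem_parentLevels.2 ⟨hpos, Or.inl ⟨rfl, ?_⟩⟩, rfl⟩)
        simpa using h'.symm
      have hl : Nat.log 2 (v / 2) + 1 = Nat.log 2 v :=
        (Nat.log_of_one_lt_of_le one_lt_two (by omega)).symm
      refine ⟨v / 2, mem_image (by omega) (by omega) (by omega), siblingTree_adj_iff.2
        ⟨by omega, mem_treeVerts.2 (by omega), hv, by omega⟩⟩
    · have hl := log_two_mul hv0
      have : v < 2 ^ (n - 1) := by omega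
      exact ⟨2 * v, mem_image (by omega) (by omega) (by omega), siblingTree_adj_iff.2
        ⟨by omega, mem_treeVerts.2 (by omega), hv, by omega⟩⟩

theorem domNum_siblingTree_eq_card {n : ℕ} (hn : 1 ≤ n) :
    domNum (siblingTree n) (treeVerts n) = (parentLevels n).card := by
  have h := isDomSetOn_image_parentLevels hn
  refine IsLeast.csInf_eq ⟨⟨_, h, le_antisymm Finset.card_image_le (card_parentLevels_le h)⟩, ?_⟩
  rintro _ ⟨S, hS, rfl⟩
  exact card_parentLevels_le hS

/-- The domination number of the sibling tree `ST_n`, `n ≥ 1`. -/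
theorem domNum_siblingTree (n : ℕ) (hn : 1 ≤ n) :
    (n % 3 = 0 → domNum (siblingTree n) (treeVerts n) = (2 ^ (n + 2) + 3) / 7) ∧
    (n % 3 = 1 → domNum (siblingTree n) (treeVerts n) = (2 ^ (n + 2) - 1) / 7) ∧
    (n % 3 = 2 → domNum (siblingTree n) (treeVerts n) = 2 * (2 ^ (n + 1) - 1) / 7) := by
  have hpow : 2 ^ (n + 2) = 2 * 2 ^ (n + 1) := by ring
  obtain ⟨h0, h1, h2⟩ := card_parentLevels n
  rw [domNum_siblingTree_eq_card hn]
  refine ⟨fun h => ?_, fun h => ?_, fun h => ?_⟩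
  · specialize h0 h
    omega
  · specialize h1 h
    omega
  · specialize h2 h
    omega
end
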